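/- arXiv:1602.01159 — 2 statements merged into one kernel-verified Lean document; each statement's English description precedes it below -/
import Mathlib

section
/- Let R be a Lie conformal algebra admitting a decomposition of ℂ[∂]-modules R = [R,R] ⊕ U, with Z(R) = 0, and let R̃ and f : QDer(R) → gc(R̃) be as defined. Then CDer(R̃) = f(QDer(R)) ⊕ ZDer(R̃): every conformal derivation of R̃ decomposes uniquely as the sum of an element of f(QDer(R)) and an element of ZDer(R̃). -/
open scoped BigOperators

universe u

/-- The data of a Lie conformal algebra over `ℂ`: a `ℂ[∂]`-module `R` (the `ℂ`-module
structure together with the operator `∂ = d`) and the family of coefficients of the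
`λ`-bracket, so that `[a_λ b] = ∑ λ^n • coeff n a b` (a polynomial in `λ` by `locality`). -/
structure LieConformalData (R : Type u) [AddCommGroup R] [Module ℂ R] where
  d : R →ₗ[ℂ] R
  coeff : ℕ → R →ₗ[ℂ] R →ₗ[ℂ] R
  locality : ∀ a b : R, ∃ N : ℕ, ∀ n : ℕ, N ≤ n → coeff n a b = 0

/-- The `λ`-bracket evaluated at a point `lam : ℂ`.  Since `ℂ` is infinite, identities
between the (polynomial) evaluation maps are equivalent to the corresponding formal
polynomial identities in the variable `λ`. -/
noncomputable def LieConformalData.brk {R : Type u} [AddCommGroup R] [Module ℂ R]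
    (L : LieConformalData R) (lam : ℂ) (a b : R) : R :=
  ∑ᶠ n : ℕ, lam ^ n • L.coeff n a b

/-- A Lie conformal algebra over `ℂ`: conformal sesquilinearity, skew-symmetry
`[a_λ b] = -[b_{-λ-∂} a]` and the Jacobi identity
`[a_λ [b_μ c]] = [[a_λ b]_{λ+μ} c] + [b_μ [a_λ c]]`. -/
structure LieConformalAlgebra (R : Type u) [AddCommGroup R] [Module ℂ R]
    extends LieConformalData R where
  sesq_left : ∀ (lam : ℂ) (a b : R),
    toLieConformalData.brk lam (d a) b = -(lam • toLieConformalData.brk lam a b)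
  sesq_right : ∀ (lam : ℂ) (a b : R),
    toLieConformalData.brk lam a (d b)
      = d (toLieConformalData.brk lam a b) + lam • toLieConformalData.brk lam a b
  skew : ∀ (lam : ℂ) (a b : R),
    toLieConformalData.brk lam a b
      = -∑ᶠ n : ℕ, ((((-lam) • (LinearMap.id : R →ₗ[ℂ] R)) - d) ^ n) (coeff n b a)
  jacobi : ∀ (lam mu : ℂ) (a b c : R),
    toLieConformalData.brk lam a (toLieConformalData.brk mu b c)
      = (∑ᶠ n : ℕ, lam ^ n • toLieConformalData.brk (lam + mu) (coeff n a b) c)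
        + toLieConformalData.brk mu b (toLieConformalData.brk lam a c)

section

variable {R : Type u} [AddCommGroup R] [Module ℂ R]

/-- A conformal linear map from `R` to `R` (an element of the general Lie conformal
algebra `gc(R)`), given by its coefficients: `D_λ(a) = ∑ λ^n • coeff n a`, satisfying
`D_λ(∂ a) = (∂ + λ) D_λ(a)`. -/
structure CLin (L : LieConformalAlgebra R) where
  coeff : ℕ → R →ₗ[ℂ] R
  locality : ∀ a : R, ∃ N : ℕ, ∀ n : ℕ, N ≤ n → coeff n a = 0
  conf : ∀ (lam : ℂ) (a : R),
    (∑ᶠ n : ℕ, lam ^ n • coeff n (L.d a))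
      = L.d (∑ᶠ n : ℕ, lam ^ n • coeff n a) + lam • ∑ᶠ n : ℕ, lam ^ n • coeff n a

variable {L : LieConformalAlgebra R}

/-- `D.app lam a` is `D_λ(a)` evaluated at `λ = lam`. -/
noncomputable def CLin.app (D : CLin L) (lam : ℂ) (a : R) : R :=
  ∑ᶠ n : ℕ, lam ^ n • D.coeff n a

/-- Conformal derivations: `D_λ([a_μ b]) = [(D_λ a)_{λ+μ} b] + [a_μ (D_λ b)]`. -/
def IsCDer (D : CLin L) : Prop :=
  ∀ (lam mu : ℂ) (a b : R),
    D.app lam (L.brk mu a b)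
      = L.brk (lam + mu) (D.app lam a) b + L.brk mu a (D.app lam b)

/-- Conformal quasiderivations: `[(D_λ a)_{λ+μ} b] + [a_μ (D_λ b)] = D'_λ([a_μ b])`. -/
def IsQDer (D : CLin L) : Prop :=
  ∃ D' : CLin L, ∀ (lam mu : ℂ) (a b : R),
    L.brk (lam + mu) (D.app lam a) b + L.brk mu a (D.app lam b)
      = D'.app lam (L.brk mu a b)

/-- Generalized conformal derivations:
`[(D_λ a)_{λ+μ} b] + [a_μ (D'_λ b)] = D''_λ([a_μ b])`. -/
def IsGDer (D : CLin L) : Prop :=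
  ∃ D' D'' : CLin L, ∀ (lam mu : ℂ) (a b : R),
    L.brk (lam + mu) (D.app lam a) b + L.brk mu a (D'.app lam b)
      = D''.app lam (L.brk mu a b)

/-- The conformal centroid: `D_λ([a_μ b]) = [(D_λ a)_{λ+μ} b] = [a_μ (D_λ b)]`. -/
def IsCent (D : CLin L) : Prop :=
  ∀ (lam mu : ℂ) (a b : R),
    D.app lam (L.brk mu a b) = L.brk (lam + mu) (D.app lam a) b ∧
    L.brk (lam + mu) (D.app lam a) b = L.brk mu a (D.app lam b)

/-- The conformal quasicentroid: `[(D_λ a)_{λ+μ} b] = [a_μ (D_λ b)]`. -/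
def IsQC (D : CLin L) : Prop :=
  ∀ (lam mu : ℂ) (a b : R),
    L.brk (lam + mu) (D.app lam a) b = L.brk mu a (D.app lam b)

/-- `ZDer(R)`: `[(D_λ a)_μ b] = D_λ([a_μ b]) = 0`. -/
def IsZDer (D : CLin L) : Prop :=
  ∀ (lam mu : ℂ) (a b : R),
    L.brk mu (D.app lam a) b = 0 ∧ D.app lam (L.brk mu a b) = 0

/-- `F` is the family of `λ`-coefficients of the bracket `[D₁ _λ D₂]` of `gc(R)`, i.e.
`[D₁ _λ D₂]_μ (a) = D₁_λ(D₂_{μ-λ}(a)) - D₂_{μ-λ}(D₁_λ(a)) = ∑ λ^n • (F n)_μ(a)`,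
with `F` eventually zero. -/
def RepBracket (D₁ D₂ : CLin L) (F : ℕ → CLin L) : Prop :=
  (∃ N : ℕ, ∀ n : ℕ, N ≤ n → ∀ (lam : ℂ) (a : R), (F n).app lam a = 0) ∧
  ∀ (lam mu : ℂ) (a : R),
    D₁.app lam (D₂.app (mu - lam) a) - D₂.app (mu - lam) (D₁.app lam a)
      = ∑ᶠ n : ℕ, lam ^ n • (F n).app mu a

end

section RTilde

variable {R : Type u} [AddCommGroup R] [Module ℂ R]

/-- The derived subalgebra `[R,R]`: the `ℂ`-span of all `λ`-coefficients of brackets. -/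
def derSpan (L : LieConformalAlgebra R) : Submodule ℂ R :=
  Submodule.span ℂ {x : R | ∃ (n : ℕ) (a b : R), x = L.coeff n a b}

/-- `D'` witnesses that `D` is a conformal quasiderivation:
`[(D_λ a)_{λ+μ} b] + [a_μ (D_λ b)] = D'_λ([a_μ b])`. -/
def QDerWitness {L : LieConformalAlgebra R} (D D' : CLin L) : Prop :=
  ∀ (lam mu : ℂ) (a b : R),
    L.brk (lam + mu) (D.app lam a) b + L.brk mu a (D.app lam b)
      = D'.app lam (L.brk mu a b)

/-- `Lt` is the Lie conformal algebra `R̃ = Rt ⊕ Rt²`, modelled on `R × R`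
(first component: coefficient of `t`; second: coefficient of `t²`), with
`∂` acting componentwise and `[at _λ bt] = [a_λ b]t²`, all other products zero. -/
def IsRTilde (L : LieConformalAlgebra R) (Lt : LieConformalAlgebra (R × R)) : Prop :=
  (∀ x : R × R, Lt.d x = (L.d x.1, L.d x.2)) ∧
  (∀ (n : ℕ) (x y : R × R), Lt.coeff n x y = (0, L.coeff n x.1 y.1))

/-- `fD` is the map `f(D) ∈ gc(R̃)` determined by
`f(D)_λ(at + bt² + ut²) = D_λ(a)t + D'_λ(b)t²` for `a ∈ R`, `b ∈ [R,R]`, `u ∈ U`. -/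
def IsFMap (L : LieConformalAlgebra R) (U : Submodule ℂ R)
    {Lt : LieConformalAlgebra (R × R)} (D D' : CLin L) (fD : CLin Lt) : Prop :=
  ∀ (lam : ℂ) (a b u : R), b ∈ derSpan L → u ∈ U →
    fD.app lam (a, b + u) = (D.app lam a, D'.app lam b)

end RTilde

section FinsumAux

variable {M N : Type*} [AddCommGroup M] [Module ℂ M] [AddCommGroup N] [Module ℂ N]

theorem finite_support_pow_smul {v : ℕ → M} (h : ∃ N : ℕ, ∀ n : ℕ, N ≤ n → v n = 0) (lam : ℂ) :
    (Function.support fun n => lam ^ n • v n).Finite := by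
  obtain ⟨K, hK⟩ := h
  refine (Set.finite_lt_nat K).subset fun n hn => ?_
  by_contra hlt
  exact hn (by simp [hK n (not_lt.mp hlt)])

theorem map_finsum_pow_smul (φ : M →ₗ[ℂ] N) {v : ℕ → M}
    (h : ∃ N : ℕ, ∀ n : ℕ, N ≤ n → v n = 0) (lam : ℂ) :
    φ (∑ᶠ n : ℕ, lam ^ n • v n) = ∑ᶠ n : ℕ, lam ^ n • φ (v n) := by
  have := φ.toAddMonoidHom.map_finsum (finite_support_pow_smul h lam)
  simpa using this

/-- A polynomial with coefficients in a complex vector space which vanishes at every point has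
vanishing coefficients. -/
theorem eq_zero_of_finsum_pow_smul_eq_zero {v : ℕ → M}
    (h : ∃ N : ℕ, ∀ n : ℕ, N ≤ n → v n = 0) (h0 : ∀ lam : ℂ, ∑ᶠ n : ℕ, lam ^ n • v n = 0) (n : ℕ) :
    v n = 0 := by
  rw [← Module.forall_dual_apply_eq_zero_iff ℂ]
  intro φ
  obtain ⟨K, hK⟩ := h
  let p : Polynomial ℂ := ∑ i ∈ Finset.range K, Polynomial.monomial i (φ (v i))
  have hp : p = 0 := by
    refine Polynomial.funext fun lam => ?_
    have h1 := congrArg φ (h0 lam)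
    rw [map_finsum_pow_smul φ ⟨K, hK⟩, map_zero,
      finsum_eq_sum_of_support_subset (s := Finset.range K)] at h1
    · simpa [p, Polynomial.eval_finsetSum, mul_comm] using h1
    · intro i hi
      by_contra hlt
      exact hi (by simp [hK i (by simpa using hlt)])
  by_cases hn : n < K
  · have h2 := congrArg (fun q => Polynomial.coeff q n) hp
    simpa [p, Polynomial.finsetSum_coeff, Polynomial.coeff_monomial, hn] using h2
  · simp [hK n (not_lt.mp hn)]

/-- The coefficients of a polynomial lie in every subspace containing all of its values. -/
theorem mem_of_finsum_pow_smul_mem (S : Submodule ℂ M) {v : ℕ → M}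
    (h : ∃ N : ℕ, ∀ n : ℕ, N ≤ n → v n = 0) (hS : ∀ lam : ℂ, ∑ᶠ n : ℕ, lam ^ n • v n ∈ S) (n : ℕ) :
    v n ∈ S := by
  rw [← Submodule.Quotient.mk_eq_zero, ← Submodule.mkQ_apply]
  refine eq_zero_of_finsum_pow_smul_eq_zero (v := fun n => S.mkQ (v n)) ?_ (fun lam => ?_) n
  · obtain ⟨K, hK⟩ := h
    exact ⟨K, fun n hn => by rw [hK n hn, map_zero]⟩
  · rw [← map_finsum_pow_smul S.mkQ h]
    simpa using hS lam

end FinsumAux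

section Bracket

variable {R : Type u} [AddCommGroup R] [Module ℂ R] (L : LieConformalAlgebra R)

theorem LieConformalData.brk_zero_left (L : LieConformalData R) (lam : ℂ) (b : R) :
    L.brk lam 0 b = 0 := by
  simp [LieConformalData.brk]

theorem LieConformalData.brk_zero_right (L : LieConformalData R) (lam : ℂ) (a : R) :
    L.brk lam a 0 = 0 := by
  simp [LieConformalData.brk]

theorem brk_mem_derSpan (lam : ℂ) (a b : R) : L.brk lam a b ∈ derSpan L :=
  finsum_induction (· ∈ derSpan L) (zero_mem _) (fun _ _ => add_mem)
    fun n => Submodule.smul_mem _ _ (Submodule.subset_span ⟨n, a, b, rfl⟩)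

variable {L}

theorem derSpan_le {S : Submodule ℂ R} (h : ∀ (lam : ℂ) (a b : R), L.brk lam a b ∈ S) :
    derSpan L ≤ S := by
  refine Submodule.span_le.mpr ?_
  rintro _ ⟨n, a, b, rfl⟩
  exact mem_of_finsum_pow_smul_mem S (L.locality a b) (fun lam => h lam a b) n

theorem d_mem_derSpan {x : R} (hx : x ∈ derSpan L) : L.d x ∈ derSpan L := by
  suffices h : derSpan L ≤ (derSpan L).comap L.d from h hx
  refine derSpan_le fun lam a b => ?_
  rw [Submodule.mem_comap, ← add_sub_cancel_right (L.d _) (lam • L.brk lam a b), ← L.sesq_right]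
  exact sub_mem (brk_mem_derSpan L _ _ _) (Submodule.smul_mem _ _ (brk_mem_derSpan L _ _ _))

theorem IsRTilde.brk {Lt : LieConformalAlgebra (R × R)} (hLt : IsRTilde L Lt) (lam : ℂ)
    (x y : R × R) : Lt.brk lam x y = (0, L.brk lam x.1 y.1) := by
  have h := map_finsum_pow_smul (LinearMap.inr ℂ R R) (L.locality x.1 y.1) lam
  simpa only [LieConformalData.brk, hLt.2, LinearMap.inr_apply] using h.symm

/-- In `R̃`, with `R` centreless, the centre is `Rt²`. -/
theorem IsRTilde.fst_eq_zero {Lt : LieConformalAlgebra (R × R)} (hLt : IsRTilde L Lt)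
    (hZ : ∀ a : R, (∀ (lam : ℂ) (b : R), L.brk lam a b = 0) → a = 0) {x : R × R}
    (hx : ∀ (lam : ℂ) (y : R × R), Lt.brk lam x y = 0) : x.1 = 0 := by
  refine hZ _ fun lam b => ?_
  simpa [hLt.brk] using hx lam (b, 0)

end Bracket

namespace CLin

variable {R R' : Type u} [AddCommGroup R] [Module ℂ R] [AddCommGroup R'] [Module ℂ R']
  {L : LieConformalAlgebra R} {L' : LieConformalAlgebra R'}

/-- The evaluation `D_λ` as a linear map. -/
noncomputable def appₗ (D : CLin L) (lam : ℂ) : R →ₗ[ℂ] R where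
  toFun := D.app lam
  map_add' a b := by
    simp only [app, map_add, smul_add]
    exact finsum_add_distrib (finite_support_pow_smul (D.locality a) lam)
      (finite_support_pow_smul (D.locality b) lam)
  map_smul' c a := by
    have h := map_finsum_pow_smul (c • LinearMap.id) (D.locality a) lam
    simpa [app] using h.symm

@[simp]
theorem appₗ_apply (D : CLin L) (lam : ℂ) (a : R) : D.appₗ lam a = D.app lam a := rfl

@[simp]
theorem app_zero (D : CLin L) (lam : ℂ) : D.app lam 0 = 0 :=
  (D.appₗ lam).map_zero

theorem app_add (D : CLin L) (lam : ℂ) (a b : R) : D.app lam (a + b) = D.app lam a + D.app lam b :=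
  (D.appₗ lam).map_add a b

theorem app_d (D : CLin L) (lam : ℂ) (a : R) :
    D.app lam (L.d a) = L.d (D.app lam a) + lam • D.app lam a :=
  D.conf lam a

/-- The conformal linear map `ψ ∘ D_λ ∘ φ`, for `φ` and `ψ` commuting with `∂`. -/
noncomputable def conj (D : CLin L) (φ : R' →ₗ[ℂ] R) (ψ : R →ₗ[ℂ] R')
    (hφ : ∀ a, φ (L'.d a) = L.d (φ a)) (hψ : ∀ a, ψ (L.d a) = L'.d (ψ a)) : CLin L' where
  coeff n := ψ ∘ₗ D.coeff n ∘ₗ φ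
  locality a := by
    obtain ⟨K, hK⟩ := D.locality (φ a)
    exact ⟨K, fun n hn => by simp [hK n hn]⟩
  conf lam a := by
    simp only [LinearMap.comp_apply]
    rw [← map_finsum_pow_smul ψ (D.locality _), ← map_finsum_pow_smul ψ (D.locality _), hφ, D.conf,
      map_add, map_smul, hψ]

@[simp]
theorem conj_app (D : CLin L) (φ : R' →ₗ[ℂ] R) (ψ : R →ₗ[ℂ] R')
    (hφ : ∀ a, φ (L'.d a) = L.d (φ a)) (hψ : ∀ a, ψ (L.d a) = L'.d (ψ a)) (lam : ℂ) (a : R') :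
    (D.conj φ ψ hφ hψ).app lam a = ψ (D.app lam (φ a)) :=
  (map_finsum_pow_smul ψ (D.locality (φ a)) lam).symm

theorem finsum_linear_comb (D E : CLin L) (c : ℂ) (lam : ℂ) (a : R) :
    (∑ᶠ n : ℕ, lam ^ n • (D.coeff n + c • E.coeff n) a) = D.app lam a + c • E.app lam a := by
  have hE := map_finsum_pow_smul (c • LinearMap.id) (E.locality a) lam
  have hs : ∃ N : ℕ, ∀ n : ℕ, N ≤ n → c • E.coeff n a = 0 := by
    obtain ⟨K, hK⟩ := E.locality a
    exact ⟨K, fun n hn => by simp [hK n hn]⟩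
  simp only [LinearMap.smul_apply, LinearMap.id_apply] at hE
  simp only [app, hE, LinearMap.add_apply, LinearMap.smul_apply, smul_add]
  exact finsum_add_distrib (finite_support_pow_smul (D.locality a) lam)
    (finite_support_pow_smul hs lam)

/-- The conformal linear map `D + c • E`. -/
noncomputable def addSMul (D : CLin L) (c : ℂ) (E : CLin L) : CLin L where
  coeff n := D.coeff n + c • E.coeff n
  locality a := by
    obtain ⟨K, hK⟩ := D.locality a
    obtain ⟨K', hK'⟩ := E.locality a
    exact ⟨max K K', fun n hn => by
      simp [hK n (le_of_max_le_left hn), hK' n (le_of_max_le_right hn)]⟩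
  conf lam a := by
    simp only [finsum_linear_comb, app_d, map_add, map_smul]
    module

@[simp]
theorem addSMul_app (D : CLin L) (c : ℂ) (E : CLin L) (lam : ℂ) (a : R) :
    (D.addSMul c E).app lam a = D.app lam a + c • E.app lam a :=
  finsum_linear_comb D E c lam a

end CLin

section RTildeDerivations

variable {R : Type u} [AddCommGroup R] [Module ℂ R] {L : LieConformalAlgebra R}
  {Lt : LieConformalAlgebra (R × R)} {U : Submodule ℂ R}

theorem IsFMap.app_of_mem {D D' : CLin L} {fD : CLin Lt} (hf : IsFMap L U D D' fD) (lam : ℂ)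
    (a : R) {b : R} (hb : b ∈ derSpan L) : fD.app lam (a, b) = (D.app lam a, D'.app lam b) := by
  simpa using hf lam a b 0 hb U.zero_mem

theorem IsFMap.fst_app {D D' : CLin L} {fD : CLin Lt} (hf : IsFMap L U D D' fD)
    (hcompl : IsCompl (derSpan L) U) (lam : ℂ) (x : R × R) : (fD.app lam x).1 = D.app lam x.1 := by
  obtain ⟨a, c⟩ := x
  obtain ⟨b, hb, u, hu, rfl⟩ :=
    Submodule.mem_sup.mp (hcompl.sup_eq_top ▸ Submodule.mem_top (x := c))
  rw [hf lam a b u hb hu]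

/-- `f(QDer(R)) + ZDer(R̃) ⊆ CDer(R̃)`. -/
theorem IsRTilde.isCDer_of_isFMap_add_isZDer (hLt : IsRTilde L Lt)
    (hZ : ∀ a : R, (∀ (lam : ℂ) (b : R), L.brk lam a b = 0) → a = 0)
    (hcompl : IsCompl (derSpan L) U) {D D' : CLin L} {fD g Dt : CLin Lt}
    (hD : QDerWitness D D') (hf : IsFMap L U D D' fD) (hg : IsZDer g)
    (hDt : ∀ (lam : ℂ) (x : R × R), Dt.app lam x = fD.app lam x + g.app lam x) : IsCDer Dt := by
  intro lam mu x y
  have hg1 (x : R × R) : (g.app lam x).1 = 0 :=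
    hLt.fst_eq_zero hZ fun mu y => (hg lam mu x y).1
  have h1 (x : R × R) : (Dt.app lam x).1 = D.app lam x.1 := by
    rw [hDt, Prod.fst_add, hf.fst_app hcompl, hg1, add_zero]
  rw [hDt, (hg lam mu x y).2, add_zero]
  simp only [hLt.brk, h1]
  rw [hf.app_of_mem lam 0 (brk_mem_derSpan L mu _ _), ← hD]
  simp

/-- Conformal derivations of `R̃` preserve `Rt²`. -/
theorem IsCDer.fst_app_inr (hLt : IsRTilde L Lt)
    (hZ : ∀ a : R, (∀ (lam : ℂ) (b : R), L.brk lam a b = 0) → a = 0) {Dt : CLin Lt}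
    (hDt : IsCDer Dt) (lam : ℂ) (b : R) : (Dt.app lam (0, b)).1 = 0 := by
  refine hZ _ fun mu c => ?_
  have h := congrArg Prod.snd (hDt lam (mu - lam) (0, b) (c, 0))
  simpa [hLt.brk, LieConformalData.brk_zero_left, ← Prod.zero_eq_mk] using h.symm

/-- `CDer(R̃) ⊆ f(QDer(R)) + ZDer(R̃)`. -/
theorem IsRTilde.exists_decomposition (hLt : IsRTilde L Lt)
    (hZ : ∀ a : R, (∀ (lam : ℂ) (b : R), L.brk lam a b = 0) → a = 0)
    (hUd : ∀ u ∈ U, L.d u ∈ U) (hcompl : IsCompl (derSpan L) U) {Dt : CLin Lt}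
    (hDt : IsCDer Dt) :
    ∃ (D D' : CLin L) (fD g : CLin Lt),
      QDerWitness D D' ∧ IsFMap L U D D' fD ∧ IsZDer g ∧
      ∀ (lam : ℂ) (x : R × R), Dt.app lam x = fD.app lam x + g.app lam x := by
  have hd : ∀ x : R × R, Lt.d x = (L.d x.1, L.d x.2) := hLt.1
  let π : R →ₗ[ℂ] R := (derSpan L).subtype ∘ₗ (derSpan L).projectionOnto U hcompl
  have hπ {b u : R} (hb : b ∈ derSpan L) (hu : u ∈ U) : π (b + u) = b := by
    have h1 := Submodule.projectionOnto_apply_left hcompl ⟨b, hb⟩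
    have h2 := Submodule.projectionOnto_apply_right hcompl ⟨u, hu⟩
    simp only at h1 h2
    simp [π, h1, h2]
  have hdπ (c : R) : π (L.d c) = L.d (π c) := by
    obtain ⟨b, hb, u, hu, rfl⟩ :=
      Submodule.mem_sup.mp (hcompl.sup_eq_top ▸ Submodule.mem_top (x := c))
    rw [map_add, hπ (d_mem_derSpan hb) (hUd u hu), hπ hb hu]
  let D : CLin L := Dt.conj (.inl ℂ R R) (.fst ℂ R R) (by simp [hd]) (by simp [hd])
  let D' : CLin L := Dt.conj (.inr ℂ R R) (.snd ℂ R R) (by simp [hd]) (by simp [hd])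
  have hD (lam : ℂ) (a : R) : D.app lam a = (Dt.app lam (a, 0)).1 := Dt.conj_app _ _ _ _ lam a
  have hD' (lam : ℂ) (b : R) : D'.app lam b = (Dt.app lam (0, b)).2 := Dt.conj_app _ _ _ _ lam b
  let E : CLin Lt := D.conj (.fst ℂ R R) (.inl ℂ R R) (by simp [hd]) (by simp [hd])
  let E' : CLin Lt :=
    D'.conj (π ∘ₗ .snd ℂ R R) (.inr ℂ R R) (by simp [hd, hdπ]) (by simp [hd])
  have hE (lam : ℂ) (x : R × R) : E.app lam x = (D.app lam x.1, 0) := D.conj_app _ _ _ _ lam x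
  have hE' (lam : ℂ) (x : R × R) : E'.app lam x = (0, D'.app lam (π x.2)) :=
    D'.conj_app _ _ _ _ lam x
  let fD : CLin Lt := E.addSMul 1 E'
  have hfD (lam : ℂ) (a c : R) : fD.app lam (a, c) = (D.app lam a, D'.app lam (π c)) := by
    simp [fD, hE, hE']
  have h1 (lam : ℂ) (x : R × R) : (Dt.app lam x).1 = D.app lam x.1 := by
    have h : x = (x.1, 0) + (0, x.2) := by simp
    rw [h, Dt.app_add, Prod.fst_add, hDt.fst_app_inr hLt hZ]
    simp [hD]
  have hg1 (lam : ℂ) (x : R × R) : ((Dt.addSMul (-1) fD).app lam x).1 = 0 := by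
    obtain ⟨a, c⟩ := x
    simp [hfD, h1]
  have hfmap : IsFMap L U D D' fD := fun lam a b u hb hu => by rw [hfD, hπ hb hu]
  refine ⟨D, D', fD, Dt.addSMul (-1) fD, fun lam mu a b => ?_, hfmap, fun lam mu x y => ⟨?_, ?_⟩,
    fun lam x => by simp⟩
  · have h := congrArg Prod.snd (hDt lam mu (a, 0) (b, 0))
    simp only [hLt.brk, h1, Prod.snd_add] at h
    simpa [hD'] using h.symm
  · rw [hLt.brk, hg1, LieConformalData.brk_zero_left, Prod.mk_zero_zero]
  · rw [hLt.brk, CLin.addSMul_app, hfmap.app_of_mem lam 0 (brk_mem_derSpan L _ _ _)]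
    have h := hDt.fst_app_inr hLt hZ lam (L.brk mu x.1 y.1)
    ext <;> simp [h, hD']

/-- The restriction of `D'` to `[R,R]` is determined by `D`. -/
theorem QDerWitness.app_eq {D₁ D₁' D₂ D₂' : CLin L} (h₁ : QDerWitness D₁ D₁')
    (h₂ : QDerWitness D₂ D₂') {lam : ℂ} (h : ∀ a, D₁.app lam a = D₂.app lam a) {b : R}
    (hb : b ∈ derSpan L) : D₁'.app lam b = D₂'.app lam b := by
  suffices hle : derSpan L ≤ LinearMap.eqLocus (D₁'.appₗ lam) (D₂'.appₗ lam) from hle hb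
  refine derSpan_le fun mu a b => ?_
  rw [LinearMap.mem_eqLocus, CLin.appₗ_apply, CLin.appₗ_apply, ← h₁, ← h₂, h, h]

theorem IsRTilde.decomposition_unique (hLt : IsRTilde L Lt)
    (hZ : ∀ a : R, (∀ (lam : ℂ) (b : R), L.brk lam a b = 0) → a = 0)
    (hcompl : IsCompl (derSpan L) U) {D₁ D₁' D₂ D₂' : CLin L} {fD₁ g₁ fD₂ g₂ : CLin Lt}
    (hD₁ : QDerWitness D₁ D₁') (hf₁ : IsFMap L U D₁ D₁' fD₁) (hg₁ : IsZDer g₁)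
    (hD₂ : QDerWitness D₂ D₂') (hf₂ : IsFMap L U D₂ D₂' fD₂) (hg₂ : IsZDer g₂) {lam : ℂ}
    (h : ∀ x : R × R, fD₁.app lam x + g₁.app lam x = fD₂.app lam x + g₂.app lam x)
    (x : R × R) : fD₁.app lam x = fD₂.app lam x := by
  have hD (a : R) : D₁.app lam a = D₂.app lam a := by
    have h' := congrArg Prod.fst (h (a, 0))
    rwa [Prod.fst_add, Prod.fst_add, hf₁.fst_app hcompl, hf₂.fst_app hcompl,
      hLt.fst_eq_zero hZ fun mu y => (hg₁ lam mu _ y).1,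
      hLt.fst_eq_zero hZ fun mu y => (hg₂ lam mu _ y).1, add_zero, add_zero] at h'
  obtain ⟨a, c⟩ := x
  obtain ⟨b, hb, u, hu, rfl⟩ :=
    Submodule.mem_sup.mp (hcompl.sup_eq_top ▸ Submodule.mem_top (x := c))
  rw [hf₁ lam a b u hb hu, hf₂ lam a b u hb hu, hD, hD₁.app_eq hD₂ hD hb]

end RTildeDerivations

/-- Let `R = [R,R] ⊕ U` as `ℂ[∂]`-modules, `Z(R) = 0`, and let
`R̃ = Rt ⊕ Rt²` and `f : QDer(R) → gc(R̃)` be as defined.  Then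
`CDer(R̃) = f(QDer(R)) ⊕ ZDer(R̃)`: every sum of an element of `f(QDer(R))` and of
`ZDer(R̃)` is a conformal derivation of `R̃`, every conformal derivation of `R̃` is such
a sum, and the decomposition is unique. -/
theorem stmt17 {R : Type u} [AddCommGroup R] [Module ℂ R] (L : LieConformalAlgebra R)
    (hZ : ∀ a : R, (∀ (lam : ℂ) (b : R), L.brk lam a b = 0) → a = 0)
    (U : Submodule ℂ R) (hUd : ∀ u ∈ U, L.d u ∈ U) (hcompl : IsCompl (derSpan L) U)
    (Lt : LieConformalAlgebra (R × R)) (hLt : IsRTilde L Lt) :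
    -- f(QDer(R)) + ZDer(R̃) ⊆ CDer(R̃)
    (∀ (D D' : CLin L) (fD g Dt : CLin Lt),
      QDerWitness D D' → IsFMap L U D D' fD → IsZDer g →
      (∀ (lam : ℂ) (x : R × R), Dt.app lam x = fD.app lam x + g.app lam x) →
      IsCDer Dt) ∧
    -- every conformal derivation of R̃ decomposes
    (∀ Dt : CLin Lt, IsCDer Dt →
      ∃ (D D' : CLin L) (fD g : CLin Lt),
        QDerWitness D D' ∧ IsFMap L U D D' fD ∧ IsZDer g ∧
        ∀ (lam : ℂ) (x : R × R), Dt.app lam x = fD.app lam x + g.app lam x) ∧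
    -- uniqueness of the decomposition
    (∀ (D₁ D₁' D₂ D₂' : CLin L) (fD₁ g₁ fD₂ g₂ : CLin Lt),
      QDerWitness D₁ D₁' → IsFMap L U D₁ D₁' fD₁ → IsZDer g₁ →
      QDerWitness D₂ D₂' → IsFMap L U D₂ D₂' fD₂ → IsZDer g₂ →
      (∀ (lam : ℂ) (x : R × R), fD₁.app lam x + g₁.app lam x = fD₂.app lam x + g₂.app lam x) →
      (∀ (lam : ℂ) (x : R × R), fD₁.app lam x = fD₂.app lam x) ∧
      (∀ (lam : ℂ) (x : R × R), g₁.app lam x = g₂.app lam x)) := by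
  exact ⟨fun _ _ _ _ _ hD hf hg hDt => hLt.isCDer_of_isFMap_add_isZDer hZ hcompl hD hf hg hDt,
    fun _ hDt => hLt.exists_decomposition hZ hUd hcompl hDt,
    fun _ _ _ _ _ _ _ _ hD₁ hf₁ hg₁ hD₂ hf₂ hg₂ h =>
      have hf lam := hLt.decomposition_unique hZ hcompl hD₁ hf₁ hg₁ hD₂ hf₂ hg₂ (h lam)
      ⟨hf, fun lam x => add_left_cancel ((h lam x).trans (by rw [hf lam x]))⟩⟩
end

section
/- For any Lie conformal algebra R and any α, β, γ ∈ ℂ, CDer_{(α,β,γ)}(R) = CDer_{(0,β−γ,γ−β)}(R) ∩ CDer_{(2α,β+γ,β+γ)}(R). -/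
open scoped BigOperators

universe u

section ABC

variable {R : Type u} [AddCommGroup R] [Module ℂ R] {L : LieConformalAlgebra R}

/-- Conformal `(α,β,γ)`-derivations:
`α • D_λ([a_μ b]) = β • [(D_λ a)_{λ+μ} b] + γ • [a_μ (D_λ b)]`. -/
def IsABCDer (α β γ : ℂ) (D : CLin L) : Prop :=
  ∀ (lam mu : ℂ) (a b : R),
    α • D.app lam (L.brk mu a b)
      = β • L.brk (lam + mu) (D.app lam a) b + γ • L.brk mu a (D.app lam b)

end ABC

/-- A polynomial identity with coefficients in a complex vector space, valid at every complex
number, remains valid when the variable is replaced by a linear operator. -/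
theorem sum_aeval_apply_eq_zero {R ι : Type*} [AddCommGroup R] [Module ℂ R] (s : Finset ι)
    (p : ι → Polynomial ℂ) (v : ι → R) (T : Module.End ℂ R)
    (h : ∀ z : ℂ, ∑ i ∈ s, (p i).eval z • v i = 0) :
    ∑ i ∈ s, Polynomial.aeval T (p i) (v i) = 0 := by
  have hcoeff (k : ℕ) : ∑ i ∈ s, (p i).coeff k • v i = 0 := by
    refine (Module.forall_dual_apply_eq_zero_iff ℂ _).1 fun φ => ?_
    have hpoly : ∑ i ∈ s, φ (v i) • p i = 0 := by
      refine Polynomial.funext fun z => ?_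
      have hz := congrArg φ (h z)
      simpa [Polynomial.eval_finsetSum, mul_comm] using hz
    have hk := congrArg (fun q => Polynomial.coeff q k) hpoly
    simpa [Polynomial.finsetSum_coeff, mul_comm] using hk
  set M := s.sup (fun i => (p i).natDegree) + 1
  have hM (i : ι) (hi : i ∈ s) :
      Polynomial.aeval T (p i) (v i) = ∑ k ∈ Finset.range M, (T ^ k) ((p i).coeff k • v i) := by
    rw [Polynomial.aeval_eq_sum_range' (n := M)
      (Nat.lt_succ_of_le (Finset.le_sup (f := fun i => (p i).natDegree) hi))]
    simp
  rw [Finset.sum_congr rfl hM, Finset.sum_comm]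
  simp_rw [← map_sum, hcoeff, map_zero, Finset.sum_const_zero]

theorem finsum_eq_sum_range_of_le {R : Type*} [AddCommGroup R] {f : ℕ → R} {N : ℕ}
    (h : ∀ n, N ≤ n → f n = 0) : ∑ᶠ n, f n = ∑ n ∈ Finset.range N, f n := by
  refine finsum_eq_sum_of_support_subset _ fun n hn => ?_
  rw [Finset.coe_range, Set.mem_Iio]
  by_contra hlt
  exact hn (h n (not_lt.1 hlt))

section

variable {R : Type u} [AddCommGroup R] [Module ℂ R] {L : LieConformalAlgebra R}

/-- The evaluation `D_λ` of a conformal linear map as a `ℂ`-linear endomorphism. -/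
noncomputable def CLin.appLinear (D : CLin L) (lam : ℂ) : R →ₗ[ℂ] R where
  toFun := D.app lam
  map_add' a b := by
    obtain ⟨A, hA⟩ := D.locality a
    obtain ⟨B, hB⟩ := D.locality b
    have ha : ∀ n, max A B ≤ n → D.coeff n a = 0 := fun n hn => hA n (le_of_max_le_left hn)
    have hb : ∀ n, max A B ≤ n → D.coeff n b = 0 := fun n hn => hB n (le_of_max_le_right hn)
    unfold CLin.app
    rw [finsum_eq_sum_range_of_le (N := max A B) (fun n hn => by simp [ha n hn, hb n hn]),
      finsum_eq_sum_range_of_le (N := max A B) (fun n hn => by simp [ha n hn]),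
      finsum_eq_sum_range_of_le (N := max A B) (fun n hn => by simp [hb n hn]),
      ← Finset.sum_add_distrib]
    simp
  map_smul' c a := by
    unfold CLin.app
    simp [smul_finsum, smul_comm c]

theorem CLin.app_d_s18 (D : CLin L) (lam : ℂ) (a : R) :
    D.app lam (L.d a) = L.d (D.app lam a) + lam • D.app lam a :=
  D.conf lam a

/-- `D_λ` intertwines the powers of `-μ - ∂` and `-(λ + μ) - ∂`. -/
theorem CLin.appLinear_pow (D : CLin L) (lam mu : ℂ) (n : ℕ) (a : R) :
    D.appLinear lam (((((-mu) • (LinearMap.id : R →ₗ[ℂ] R)) - L.d) ^ n) a)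
      = ((((-(lam + mu)) • (LinearMap.id : R →ₗ[ℂ] R)) - L.d) ^ n) (D.appLinear lam a) := by
  induction n generalizing a with
  | zero => simp
  | succ n ih =>
    rw [pow_succ, pow_succ, Module.End.mul_apply, Module.End.mul_apply, ih]
    congr 1
    have hd : D.appLinear lam (L.d a) = L.d (D.appLinear lam a) + lam • D.appLinear lam a :=
      D.app_d_s18 lam a
    simp only [LinearMap.sub_apply, LinearMap.smul_apply, LinearMap.id_apply, map_sub, map_smul,
      hd]
    module

/-- By skew-symmetry, the roles of `β` and `γ` can be exchanged. -/
theorem IsABCDer.swap {α β γ : ℂ} {D : CLin L} (h : IsABCDer α β γ D) :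
    IsABCDer α γ β D := by
  intro lam mu a b
  obtain ⟨N₁, h₁⟩ := L.locality b a
  obtain ⟨N₂, h₂⟩ := L.locality (D.app lam b) a
  obtain ⟨N₃, h₃⟩ := L.locality b (D.app lam a)
  obtain ⟨N, hN₁, hN₂, hN₃⟩ : ∃ N, N₁ ≤ N ∧ N₂ ≤ N ∧ N₃ ≤ N :=
    ⟨max N₁ (max N₂ N₃), by simp, by simp, by simp⟩
  replace h₁ : ∀ n, N ≤ n → L.coeff n b a = 0 := fun n hn => h₁ n (hN₁.trans hn)
  replace h₂ : ∀ n, N ≤ n → L.coeff n (D.app lam b) a = 0 := fun n hn => h₂ n (hN₂.trans hn)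
  replace h₃ : ∀ n, N ≤ n → L.coeff n b (D.app lam a) = 0 := fun n hn => h₃ n (hN₃.trans hn)
  set T : Module.End ℂ R := ((-(lam + mu)) • (LinearMap.id : R →ₗ[ℂ] R)) - L.d with hT
  set S : Module.End ℂ R := ((-mu) • (LinearMap.id : R →ₗ[ℂ] R)) - L.d with hS
  have key := sum_aeval_apply_eq_zero (Finset.univ ×ˢ Finset.range N)
    (fun i : Fin 3 × ℕ => ![Polynomial.X ^ i.2, (Polynomial.C lam + Polynomial.X) ^ i.2,
      Polynomial.X ^ i.2] i.1)
    (fun i => ![α • D.appLinear lam (L.coeff i.2 b a), -(β • L.coeff i.2 (D.app lam b) a),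
      -(γ • L.coeff i.2 b (D.app lam a))] i.1) T (by
    intro z
    have hz := h lam z b a
    unfold LieConformalData.brk at hz
    rw [finsum_eq_sum_range_of_le (fun n hn => by rw [h₁ n hn, smul_zero]),
      finsum_eq_sum_range_of_le (fun n hn => by rw [h₂ n hn, smul_zero]),
      finsum_eq_sum_range_of_le (fun n hn => by rw [h₃ n hn, smul_zero])] at hz
    change α • D.appLinear lam _ = _ at hz
    simp only [map_sum, map_smul, Finset.smul_sum] at hz
    simp only [Finset.sum_product, Fin.sum_univ_three]
    simp [smul_comm _ α, smul_comm _ β, smul_comm _ γ, hz])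
  have hTS : algebraMap ℂ (Module.End ℂ R) lam + T = S := by
    ext x
    simp only [hT, hS, LinearMap.add_apply, LinearMap.sub_apply, LinearMap.smul_apply,
      LinearMap.id_apply, Module.algebraMap_end_apply]
    module
  have e₁ : D.app lam (L.brk mu a b)
      = -∑ n ∈ Finset.range N, (T ^ n) (D.appLinear lam (L.coeff n b a)) := by
    rw [L.skew, finsum_eq_sum_range_of_le (fun n hn => by rw [h₁ n hn, map_zero])]
    change D.appLinear lam _ = _
    simp only [map_neg, map_sum, D.appLinear_pow, hT]
  have e₂ : L.brk mu a (D.app lam b)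
      = -∑ n ∈ Finset.range N, (S ^ n) (L.coeff n (D.app lam b) a) := by
    rw [L.skew, finsum_eq_sum_range_of_le (fun n hn => by rw [h₂ n hn, map_zero])]
  have e₃ : L.brk (lam + mu) (D.app lam a) b
      = -∑ n ∈ Finset.range N, (T ^ n) (L.coeff n b (D.app lam a)) := by
    rw [L.skew, finsum_eq_sum_range_of_le (fun n hn => by rw [h₃ n hn, map_zero])]
  simp only [Finset.sum_product, Fin.sum_univ_three] at key
  simp only [Matrix.cons_val, map_pow, map_add, Polynomial.aeval_X, Polynomial.aeval_C, hTS,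
    map_neg, map_smul, Finset.sum_neg_distrib, ← Finset.smul_sum] at key
  rw [e₁, e₂, e₃]
  linear_combination (norm := module) -key

end

/-- For any Lie conformal algebra `R` and any `α, β, γ ∈ ℂ`,
`CDer_{(α,β,γ)}(R) = CDer_{(0,β-γ,γ-β)}(R) ∩ CDer_{(2α,β+γ,β+γ)}(R)`. -/
theorem stmt18 {R : Type u} [AddCommGroup R] [Module ℂ R] (L : LieConformalAlgebra R)
    (α β γ : ℂ) :
    ∀ D : CLin L, IsABCDer α β γ D ↔
      (IsABCDer 0 (β - γ) (γ - β) D ∧ IsABCDer (2 * α) (β + γ) (β + γ) D) := by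
  intro D
  constructor
  · intro h
    refine ⟨fun lam mu a b => ?_, fun lam mu a b => ?_⟩
    · linear_combination (norm := module) h lam mu a b - h.swap lam mu a b
    · linear_combination (norm := module) h lam mu a b + h.swap lam mu a b
  · rintro ⟨h₁, h₂⟩ lam mu a b
    linear_combination (norm := module)
      (1 / 2 : ℂ) • h₁ lam mu a b + (1 / 2 : ℂ) • h₂ lam mu a b
end
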